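/- The presented group on three generators x₁, x₂, x₃ with relators x₁^2, x₁*u*x₃*u⁻¹ where u = x₃⁻¹*x₁*x₃⁻¹, and x₂*v*x₃*v⁻¹ where v = x₁⁻¹*x₂⁻¹*x₃⁻¹*x₂, is isomorphic to the presented group on three generators x₁, x₂, x₃ with relators x₁^2, x₂^2, x₃^2, (x₁*x₂)^2*((x₂*x₃)^3)⁻¹ and (x₁*x₃)^3. (This is the fundamental group computation for τ_{R(D(12a₉₉₀))} in Remark 4.19.) -/

import Mathlib

/-- The generator `x₁` of the free group on three generators. -/
def x1 : FreeGroup (Fin 3) := FreeGroup.of 0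

/-- The generator `x₂` of the free group on three generators. -/
def x2 : FreeGroup (Fin 3) := FreeGroup.of 1

/-- The generator `x₃` of the free group on three generators. -/
def x3 : FreeGroup (Fin 3) := FreeGroup.of 2

/-- The relators of the Coxeter-like presentation
`⟨x₁, x₂, x₃ ∣ x₁² = x₂² = x₃² = 1, (x₁x₂)² = (x₂x₃)³, (x₁x₃)³ = 1⟩`. -/
def targetRels : Set (FreeGroup (Fin 3)) :=
  {x1 ^ 2, x2 ^ 2, x3 ^ 2, (x1 * x2) ^ 2 * ((x2 * x3) ^ 3)⁻¹, (x1 * x3) ^ 3}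

/-- The word `u = x₃⁻¹x₁x₃⁻¹`. -/
def u : FreeGroup (Fin 3) := x3⁻¹ * x1 * x3⁻¹

/-- The word `v = x₁⁻¹x₂⁻¹x₃⁻¹x₂`. -/
def v : FreeGroup (Fin 3) := x1⁻¹ * x2⁻¹ * x3⁻¹ * x2

/-- The τ-presentation relators of `π₁(τ_{R(D(12a₉₉₀))})`. -/
def rels14 : Set (FreeGroup (Fin 3)) :=
  {x1 ^ 2, x1 * u * x3 * u⁻¹, x2 * v * x3 * v⁻¹}

/-- In any group, the relations of the `τ`-presentation are equivalent to the Coxeter-like ones. -/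
theorem tau_relations_iff {G : Type*} [Group G] (a b c : G) :
    (a ^ 2 = 1 ∧ a * (c⁻¹ * a * c⁻¹) * c * (c⁻¹ * a * c⁻¹)⁻¹ = 1 ∧
      b * (a⁻¹ * b⁻¹ * c⁻¹ * b) * c * (a⁻¹ * b⁻¹ * c⁻¹ * b)⁻¹ = 1) ↔
    (a ^ 2 = 1 ∧ b ^ 2 = 1 ∧ c ^ 2 = 1 ∧ (a * b) ^ 2 * ((b * c) ^ 3)⁻¹ = 1 ∧
      (a * c) ^ 3 = 1) := by
  have inv_of_sq (x : G) (hx : x ^ 2 = 1) : x⁻¹ = x :=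
    inv_eq_of_mul_eq_one_left (by rwa [← sq])
  have sq_of_rel (x y w : G) (hx : x ^ 2 = 1) (h : x * w * y * w⁻¹ = 1) : y ^ 2 = 1 := by
    have hy : y = w⁻¹ * x⁻¹ * w := by
      rw [← mul_one (w⁻¹ * x⁻¹), ← h]
      group
    calc y ^ 2 = w⁻¹ * (x ^ 2)⁻¹ * w := by rw [hy, sq]; group
      _ = 1 := by rw [hx]; group
  have sq_of_rel' (x y w : G) (hy : y ^ 2 = 1) (h : x * w * y * w⁻¹ = 1) : x ^ 2 = 1 := by
    have hx : x = w * y⁻¹ * w⁻¹ := by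
      rw [← one_mul (w * y⁻¹ * w⁻¹), ← h]
      group
    calc x ^ 2 = w * (y ^ 2)⁻¹ * w⁻¹ := by rw [hx, sq]; group
      _ = 1 := by rw [hy]; group
  have ac_eq (ha : a ^ 2 = 1) (hc : c ^ 2 = 1) :
      a * (c⁻¹ * a * c⁻¹) * c * (c⁻¹ * a * c⁻¹)⁻¹ = (a * c) ^ 3 := by
    simp only [mul_inv_rev, inv_of_sq a ha, inv_of_sq c hc, pow_succ, pow_zero, one_mul]
    rw [sq] at hc
    simp only [mul_assoc, mul_one, hc]
  have ab_iff (ha : a ^ 2 = 1) (hb : b ^ 2 = 1) (hc : c ^ 2 = 1) :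
      b * (a⁻¹ * b⁻¹ * c⁻¹ * b) * c * (a⁻¹ * b⁻¹ * c⁻¹ * b)⁻¹ = 1 ↔
        (a * b) ^ 2 * ((b * c) ^ 3)⁻¹ = 1 := by
    have hword : b * (a⁻¹ * b⁻¹ * c⁻¹ * b) * c * (a⁻¹ * b⁻¹ * c⁻¹ * b)⁻¹ =
        (b * a) * (b * c) ^ 3 * (b * a) := by
      simp only [mul_inv_rev, inv_of_sq a ha, inv_of_sq b hb, inv_of_sq c hc, pow_succ,
        pow_zero, one_mul, mul_assoc]
    have hinv : (b * a)⁻¹ = a * b := by rw [mul_inv_rev, inv_of_sq a ha, inv_of_sq b hb]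
    rw [hword, mul_inv_eq_one, mul_eq_one_iff_eq_inv, ← eq_inv_mul_iff_mul_eq, hinv, ← sq, eq_comm]
  constructor
  · rintro ⟨ha, h₁, h₂⟩
    have hc := sq_of_rel _ _ _ ha h₁
    have hb := sq_of_rel' _ _ _ hc h₂
    exact ⟨ha, hb, hc, (ab_iff ha hb hc).1 h₂, ac_eq ha hc ▸ h₁⟩
  · rintro ⟨ha, hb, hc, h₁, h₂⟩
    exact ⟨ha, (ac_eq ha hc).trans h₂, (ab_iff ha hb hc).2 h₁⟩

/-- A normal subgroup contains one set of relators if and only if it contains the other. -/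
theorem rels14_subset_iff (N : Subgroup (FreeGroup (Fin 3))) [N.Normal] :
    rels14 ⊆ N ↔ targetRels ⊆ N := by
  simpa only [rels14, targetRels, u, v, Set.insert_subset_iff, Set.singleton_subset_iff,
    SetLike.mem_coe, ← QuotientGroup.eq_one_iff, QuotientGroup.mk_mul, QuotientGroup.mk_inv,
    QuotientGroup.mk_pow] using
    tau_relations_iff (x1 : FreeGroup (Fin 3) ⧸ N) (x2 : FreeGroup (Fin 3) ⧸ N) x3

/-- The two sets of relators have the same normal closure. -/
theorem normalClosure_rels14 :
    Subgroup.normalClosure rels14 = Subgroup.normalClosure targetRels :=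
  le_antisymm
    (Subgroup.normalClosure_le_normal
      ((rels14_subset_iff _).2 Subgroup.subset_normalClosure))
    (Subgroup.normalClosure_le_normal
      ((rels14_subset_iff _).1 Subgroup.subset_normalClosure))

/-- The fundamental group of the Price twist `τ_{R(D(12a₉₉₀))}` is isomorphic to
`⟨x₁, x₂, x₃ ∣ x₁² = x₂² = x₃² = 1, (x₁x₂)² = (x₂x₃)³, (x₁x₃)³ = 1⟩`. -/
theorem stmt_14 : Nonempty (PresentedGroup rels14 ≃* PresentedGroup targetRels) := by
  exact ⟨QuotientGroup.quotientMulEquivOfEq normalClosure_rels14⟩
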